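/- For any function v of class C² on the closed unit disc in ℝ² and any radius 0 ≤ r ≤ 1, the integral of |D²v| over the circle ∂B_r is at least the square root of 4π times the absolute value of the integral of det D²v over the disc B_r. -/

import Mathlib

open MeasureTheory Metric

noncomputable section

abbrev E2 : Type := EuclideanSpace ℝ (Fin 2)

def e2 (i : Fin 2) : E2 := EuclideanSpace.single i (1 : ℝ)

/-- The closed unit disc in `ℝ²`. -/
def D : Set E2 := closedBall (0 : E2) 1

/-- Entry `(i,j)` of the Hessian matrix of `f` at `x`, computed within the
closed unit disc. -/
noncomputable def hessD (f : E2 → ℝ) (x : E2) (i j : Fin 2) : ℝ :=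
  fderivWithin ℝ (fun z => fderivWithin ℝ f D z (e2 i)) D x (e2 j)

/-- Frobenius norm of the Hessian of `f` at `x`. -/
noncomputable def hessFrobD (f : E2 → ℝ) (x : E2) : ℝ :=
  Real.sqrt (∑ i, ∑ j, (hessD f x i j) ^ 2)

/-- Determinant of the Hessian of `f` at `x`. -/
noncomputable def hessDetD (f : E2 → ℝ) (x : E2) : ℝ :=
  hessD f x 0 0 * hessD f x 1 1 - hessD f x 0 1 * hessD f x 1 0

theorem mul_sin_add_cos_le {x y w s c z k : ℝ} (hk : 0 < k) (hw : 0 < w)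
    (hxy : x ^ 2 + y ^ 2 ≤ w ^ 2) (hsc : s ^ 2 + c ^ 2 = 1) :
    z * (s * x + c * y) ≤ w / (2 * k) + k * z ^ 2 * w / 2 := by
  have h1 : |s * x + c * y| ≤ w := by
    apply abs_le_of_sq_le_sq _ hw.le
    nlinarith [sq_nonneg (s * y - c * x)]
  have h2 : z * (s * x + c * y) ≤ |z| * w := by
    calc _ ≤ |z * (s * x + c * y)| := le_abs_self _
      _ = |z| * |s * x + c * y| := abs_mul _ _
      _ ≤ _ := by gcongr
  have h3 : w / (2 * k) + k * z ^ 2 * w / 2 - |z| * w = w * (k * |z| - 1) ^ 2 / (2 * k) := by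
    rw [← sq_abs z]
    field_simp
    ring
  have : 0 ≤ w * (k * |z| - 1) ^ 2 / (2 * k) := by positivity
  linarith

/-- Area bound for an arc whose endpoints lie on the axis `y = 0`, by calibration: the derivative
of `y ^ 2 * cot T / 2` plus the area density `y * x'` is at most `w / (2 * k)`. -/
theorem integral_mul_deriv_le_of_chord {y T x' y' w : ℝ → ℝ} {a b k : ℝ} (hab : a ≤ b)
    (hk : 0 < k) (hx'c : Continuous x')
    (hy : ∀ t, HasDerivAt y (y' t) t) (hT : ∀ t, HasDerivAt T (k * w t) t)
    (hwc : Continuous w) (hw : ∀ t, 0 < w t)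
    (hxy : ∀ t, x' t ^ 2 + y' t ^ 2 ≤ w t ^ 2)
    (hTa : T a = 0) (hTb : T b = Real.pi) (hya : y a = 0) (hyb : y b = 0) :
    ∫ t in a..b, y t * x' t ≤ Real.pi / (2 * k ^ 2) := by
  have hyc : Continuous y := continuous_iff_continuousAt.2 fun t => (hy t).continuousAt
  have hTc : Continuous T := continuous_iff_continuousAt.2 fun t => (hT t).continuousAt
  have hTm : StrictMono T := strictMono_of_hasDerivAt_pos hT fun t => mul_pos hk (hw t)
  have hy'w : ∀ t, |y' t| ≤ w t := fun t =>
    abs_le_of_sq_le_sq (by nlinarith [hxy t, sq_nonneg (x' t)]) (hw t).le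
  have hm1 : Monotone fun t => T t / k - y t := by
    refine monotone_of_hasDerivAt_nonneg (fun t => ((hT t).div_const k).sub (hy t)) fun t => ?_
    have := (abs_le.1 (hy'w t)).2
    have : k * w t / k = w t := by field_simp
    simp only [Pi.zero_apply]; linarith
  have hm2 : Monotone fun t => T t / k + y t := by
    refine monotone_of_hasDerivAt_nonneg (fun t => ((hT t).div_const k).add (hy t)) fun t => ?_
    have := (abs_le.1 (hy'w t)).1
    have : k * w t / k = w t := by field_simp
    simp only [Pi.zero_apply]; linarith
  have hT0 : ∀ t ∈ Set.Icc a b, 0 ≤ T t := fun t ht => hTa ▸ hTm.monotone ht.1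
  have hTpi : ∀ t ∈ Set.Icc a b, T t ≤ Real.pi := fun t ht => hTb ▸ hTm.monotone ht.2
  have hb : ∀ t ∈ Set.Icc a b, |y t| ≤ Real.pi / (2 * k) * Real.sin (T t) := by
    intro t ht
    have h1 := hm1 ht.1
    have h2 := hm1 ht.2
    have h3 := hm2 ht.1
    have h4 := hm2 ht.2
    simp only [hTa, hTb, hya, hyb, zero_div, sub_zero, add_zero] at h1 h2 h3 h4
    have hpi := Real.pi_pos
    have key : ∀ τ, 0 ≤ τ → τ ≤ Real.pi / 2 → τ / k ≤ Real.pi / (2 * k) * Real.sin τ := by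
      intro τ h0 h1
      have := Real.mul_le_sin h0 h1
      calc τ / k = Real.pi / (2 * k) * (2 / Real.pi * τ) := by field_simp
        _ ≤ _ := by gcongr
    rcases le_total (T t) (Real.pi / 2) with h | h
    · refine le_trans (abs_le.2 ⟨?_, ?_⟩) (key _ (hT0 t ht) h) <;> linarith
    · have := key (Real.pi - T t) (by linarith [hTpi t ht]) (by linarith)
      rw [Real.sin_pi_sub, sub_div] at this
      refine le_trans (abs_le.2 ⟨?_, ?_⟩) this <;> linarith
  set G : ℝ → ℝ := fun t => 1 / 2 * (y t ^ 2 * (Real.cos (T t) / Real.sin (T t))) with hG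
  have hsin : ∀ t ∈ Set.Ioo a b, 0 < Real.sin (T t) := fun t ht =>
    Real.sin_pos_of_pos_of_lt_pi (hTa ▸ hTm ht.1) (hTb ▸ hTm ht.2)
  have hGd : ∀ t ∈ Set.Ioo a b, HasDerivAt G (1 / 2 * (2 * y t * y' t *
      (Real.cos (T t) / Real.sin (T t)) - y t ^ 2 * (k * w t / Real.sin (T t) ^ 2))) t := by
    intro t ht
    have hs := (hsin t ht).ne'
    have := (((hy t).pow 2).mul (((hT t).cos).div ((hT t).sin) hs)).const_mul (1 / 2 : ℝ)
    refine this.congr_deriv ?_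
    have hsc := Real.sin_sq_add_cos_sq (T t)
    have h2 : (-Real.sin (T t) * (k * w t) * Real.sin (T t) - Real.cos (T t) *
      (Real.cos (T t) * (k * w t))) / Real.sin (T t) ^ 2 = -(k * w t / Real.sin (T t) ^ 2) := by
      rw [← neg_div]; congr 1; linear_combination (-(k * w t)) * hsc
    simp only [Pi.pow_apply, Pi.div_apply, h2]
    push_cast
    ring
  have hGb : ∀ t ∈ Set.Icc a b, |G t| ≤ Real.pi / (4 * k) * |y t| := by
    intro t ht
    have hpi := Real.pi_pos
    have hs0 : 0 ≤ Real.sin (T t) := Real.sin_nonneg_of_nonneg_of_le_pi (hT0 t ht) (hTpi t ht)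
    rcases hs0.eq_or_lt with h | h
    · simp only [hG, ← h, div_zero, mul_zero, abs_zero]; positivity
    · have h1 : |y t| / Real.sin (T t) ≤ Real.pi / (2 * k) := by
        rw [div_le_iff₀ h]; exact hb t ht
      calc |G t| = 1 / 2 * |y t| * (|y t| / Real.sin (T t)) * |Real.cos (T t)| := by
            simp only [hG, abs_mul, abs_div, abs_pow, abs_of_pos h]; norm_num; rw [← sq_abs (y t)]; ring
        _ ≤ 1 / 2 * |y t| * (Real.pi / (2 * k)) * 1 := by
            gcongr; exact Real.abs_cos_le_one _
        _ = _ := by ring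
  have hGa0 : ∀ t, y t = 0 → G t = 0 := fun t h => by simp [hG, h]
  have hGend : ∀ t, y t = 0 → ContinuousWithinAt G (Set.Icc a b) t := by
    intro t h
    rw [ContinuousWithinAt, hGa0 t h]
    have : Filter.Tendsto (fun t => Real.pi / (4 * k) * |y t|) (nhdsWithin t (Set.Icc a b))
        (nhds 0) := by
      have : Continuous fun t => Real.pi / (4 * k) * |y t| := by fun_prop
      simpa [h] using (this.tendsto t).mono_left nhdsWithin_le_nhds
    refine squeeze_zero_norm' ?_ this
    filter_upwards [self_mem_nhdsWithin] with s hs using hGb s hs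
  have hGc : ContinuousOn G (Set.Icc a b) := by
    intro t ht
    rcases ht.1.eq_or_lt with h | h
    · subst h; exact hGend _ hya
    rcases ht.2.eq_or_lt with h' | h'
    · subst h'; exact hGend _ hyb
    exact (hGd t ⟨h, h'⟩).continuousAt.continuousWithinAt
  have hφc : Continuous fun t => w t / (2 * k) - y t * x' t := by fun_prop
  have main := intervalIntegral.sub_le_integral_of_hasDeriv_right_of_le
    (φ := fun t => w t / (2 * k) - y t * x' t) hab hGc
    (fun t ht => (hGd t ht).hasDerivWithinAt) hφc.continuousOn.integrableOn_Icc (by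
      intro t ht
      have hs := (hsin t ht)
      have := mul_sin_add_cos_le (z := y t / Real.sin (T t)) hk (hw t) (hxy t)
        (Real.sin_sq_add_cos_sq (T t))
      have e1 : y t / Real.sin (T t) * (Real.sin (T t) * x' t + Real.cos (T t) * y' t) =
        y t * x' t + y t * y' t * (Real.cos (T t) / Real.sin (T t)) := by
        field_simp
      rw [e1] at this
      have e2 : k * (y t / Real.sin (T t)) ^ 2 * w t / 2 =
        1 / 2 * (y t ^ 2 * (k * w t / Real.sin (T t) ^ 2)) := by
        field_simp
      rw [e2] at this
      linarith)
  have hyx' : Continuous fun t => y t * x' t := hyc.mul hx'c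
  rw [hGa0 a hya, hGa0 b hyb, sub_zero, intervalIntegral.integral_sub
    ((hwc.div_const _).intervalIntegrable _ _) (hyx'.intervalIntegrable _ _)] at main
  have hwi : ∫ t in a..b, w t / (2 * k) = Real.pi / (2 * k ^ 2) := by
    have hd : ∀ t, HasDerivAt (fun t => T t / (2 * k ^ 2)) (w t / (2 * k)) t := fun t =>
      ((hT t).div_const (2 * k ^ 2)).congr_deriv (by field_simp)
    rw [intervalIntegral.integral_eq_sub_of_hasDerivAt (fun t _ => hd t)
      ((hwc.div_const _).intervalIntegrable _ _), hTa, hTb]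
    simp
  linarith

/-- The isoperimetric inequality for the oriented area of a closed curve whose speed is bounded
by a positive function. -/
theorem integral_mul_deriv_le_of_closed {x y x' y' w : ℝ → ℝ} {a b : ℝ} (hab : a < b)
    (hx : ∀ t, HasDerivAt x (x' t) t) (hy : ∀ t, HasDerivAt y (y' t) t)
    (hx'c : Continuous x') (hy'c : Continuous y') (hwc : Continuous w) (hw : ∀ t, 0 < w t)
    (hxy : ∀ t, x' t ^ 2 + y' t ^ 2 ≤ w t ^ 2) (hxab : x a = x b) (hyab : y a = y b) :
    4 * Real.pi * ∫ t in a..b, y t * x' t ≤ (∫ t in a..b, w t) ^ 2 := by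
  have hpi := Real.pi_pos
  set L := ∫ t in a..b, w t with hL
  have hLpos : 0 < L := intervalIntegral.intervalIntegral_pos_of_pos
    (hwc.intervalIntegrable _ _) hw hab
  have hyc : Continuous y := continuous_iff_continuousAt.2 fun t => (hy t).continuousAt
  have hxc : Continuous x := continuous_iff_continuousAt.2 fun t => (hx t).continuousAt
  set k := 2 * Real.pi / L with hk
  have hkpos : 0 < k := by positivity
  set T : ℝ → ℝ := fun t => k * ∫ s in a..t, w s with hTdef
  have hT : ∀ t, HasDerivAt T (k * w t) t := fun t =>
    (hwc.integral_hasStrictDerivAt a t).hasDerivAt.const_mul k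
  have hTa : T a = 0 := by simp [hTdef]
  have hTb : T b = 2 * Real.pi := by
    simp only [hTdef, ← hL, hk]; field_simp
  have hTc : Continuous T := continuous_iff_continuousAt.2 fun t => (hT t).continuousAt
  obtain ⟨m, ⟨ham, hmb⟩, hTm⟩ : ∃ m ∈ Set.Icc a b, T m = Real.pi := by
    apply intermediate_value_Icc hab.le hTc.continuousOn
    rw [hTa, hTb]; constructor <;> linarith
  obtain ⟨α, β, h1, h0⟩ : ∃ α β : ℝ, α ^ 2 + β ^ 2 = 1 ∧
      α * (y m - y a) - β * (x m - x a) = 0 := by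
    by_cases h : (x m - x a) ^ 2 + (y m - y a) ^ 2 = 0
    · refine ⟨1, 0, by norm_num, ?_⟩
      have : (y m - y a) ^ 2 = 0 := by nlinarith [sq_nonneg (x m - x a), sq_nonneg (y m - y a)]
      simp [pow_eq_zero_iff (two_ne_zero) |>.1 this]
    · set d := (x m - x a) ^ 2 + (y m - y a) ^ 2
      have hd : 0 < d := lt_of_le_of_ne (by positivity) (Ne.symm h)
      refine ⟨(x m - x a) / √d, (y m - y a) / √d, ?_, by ring⟩
      rw [div_pow, div_pow, Real.sq_sqrt hd.le, ← add_div, div_self h]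
  set c := α * y a - β * x a with hc
  set X' : ℝ → ℝ := fun t => α * x' t + β * y' t with hX'
  set Y : ℝ → ℝ := fun t => α * y t - β * x t - c with hYdef
  set Y' : ℝ → ℝ := fun t => α * y' t - β * x' t with hY'
  have hX'c : Continuous X' := by fun_prop
  have hYc : Continuous Y := by fun_prop
  have hYX' : Continuous fun t => Y t * X' t := hYc.mul hX'c
  have hyx' : Continuous fun t => y t * x' t := hyc.mul hx'c
  have hY : ∀ t, HasDerivAt Y (Y' t) t := fun t =>
    (((hy t).const_mul α).sub ((hx t).const_mul β)).sub_const c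
  have hXY : ∀ t, X' t ^ 2 + Y' t ^ 2 ≤ w t ^ 2 := fun t => by
    have : X' t ^ 2 + Y' t ^ 2 = (α ^ 2 + β ^ 2) * (x' t ^ 2 + y' t ^ 2) := by
      simp only [hX', hY']; ring
    rw [this, h1, one_mul]; exact hxy t
  have hYa : Y a = 0 := by simp [hYdef, hc]
  have hYb : Y b = 0 := by simp [hYdef, hc, hxab, hyab]
  have hYm : Y m = 0 := by simp only [hYdef, hc]; linarith
  have I1 := integral_mul_deriv_le_of_chord ham hkpos hX'c hY hT hwc hw hXY hTa hTm hYa hYm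
  have I2 := integral_mul_deriv_le_of_chord (T := fun t => T t - Real.pi) hmb hkpos hX'c hY
    (fun t => (hT t).sub_const _) hwc hw hXY (by simp [hTm]) (by rw [hTb]; ring) hYm hYb
  have I3 := intervalIntegral.integral_add_adjacent_intervals
    (hYX'.intervalIntegrable a m) (hYX'.intervalIntegrable (μ := volume) m b)
  have hrot : ∫ t in a..b, Y t * X' t = ∫ t in a..b, y t * x' t := by
    set P : ℝ → ℝ := fun t => -β ^ 2 * (x t * y t) + α * β / 2 * (y t ^ 2 - x t ^ 2)
      - c * (α * x t + β * y t)
    have hP : ∀ t, HasDerivAt P (Y t * X' t - y t * x' t) t := fun t => by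
      have := ((((hx t).mul (hy t)).const_mul (-β ^ 2)).add
        ((((hy t).pow 2).sub ((hx t).pow 2)).const_mul (α * β / 2))).sub
        ((((hx t).const_mul α).add ((hy t).const_mul β)).const_mul c)
      refine this.congr_deriv ?_
      simp only [hYdef, hX']
      push_cast
      linear_combination (-(y t * x' t)) * h1
    have := intervalIntegral.integral_eq_sub_of_hasDerivAt (a := a) (b := b) (fun t _ => hP t)
      (Continuous.intervalIntegrable (by fun_prop) _ _)
    rw [intervalIntegral.integral_sub (hYX'.intervalIntegrable _ _)
      (hyx'.intervalIntegrable _ _)] at this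
    have hPab : P b - P a = 0 := by simp only [P, hxab, hyab]; ring
    linarith
  rw [← hrot, ← I3]
  have hk2 : Real.pi / (2 * k ^ 2) = L ^ 2 / (8 * Real.pi) := by
    rw [hk]; field_simp; norm_num
  rw [hk2] at I1 I2
  calc _ ≤ 4 * Real.pi * (L ^ 2 / (8 * Real.pi) + L ^ 2 / (8 * Real.pi)) := by gcongr
    _ = L ^ 2 := by field_simp; norm_num

/-- The isoperimetric inequality for the area of a closed `C¹` curve whose speed is at most `g`. -/
theorem abs_integral_mul_deriv_le_of_closed {x y x' y' g : ℝ → ℝ} {a b : ℝ} (hab : a < b)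
    (hx : ∀ t, HasDerivAt x (x' t) t) (hy : ∀ t, HasDerivAt y (y' t) t)
    (hx'c : Continuous x') (hy'c : Continuous y') (hgc : Continuous g) (hg : ∀ t, 0 ≤ g t)
    (hxy : ∀ t, x' t ^ 2 + y' t ^ 2 ≤ g t ^ 2) (hxab : x a = x b) (hyab : y a = y b) :
    4 * Real.pi * |∫ t in a..b, y t * x' t| ≤ (∫ t in a..b, g t) ^ 2 := by
  have key : ∀ ε > 0, 4 * Real.pi * |∫ t in a..b, y t * x' t| ≤
      (∫ t in a..b, g t + ε) ^ 2 := by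
    intro ε hε
    have hb : ∀ t, g t ^ 2 ≤ (g t + ε) ^ 2 := fun t => by
      have := hg t; gcongr; linarith
    have hp : ∀ t, 0 < g t + ε := fun t => by linarith [hg t]
    have h1 := integral_mul_deriv_le_of_closed (w := fun t => g t + ε) hab hx hy hx'c hy'c
      (by fun_prop) hp (fun t => (hxy t).trans (hb t)) hxab hyab
    have h2 := integral_mul_deriv_le_of_closed (w := fun t => g t + ε) hab
      (fun t => (hx t).neg) hy hx'c.neg hy'c
      (by fun_prop) hp (fun t => by rw [neg_sq]; exact (hxy t).trans (hb t))
      (by simp [hxab]) hyab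
    simp only [mul_neg, intervalIntegral.integral_neg] at h2
    rcases abs_cases (∫ t in a..b, y t * x' t) with h | h <;> rw [h.1]
    · exact h1
    · linarith
  have hcont : Continuous fun ε : ℝ => (∫ t in a..b, g t + ε) ^ 2 :=
    (intervalIntegral.continuous_parametric_intervalIntegral_of_continuous'
      (by fun_prop) a b).pow 2
  have := ge_of_tendsto ((hcont.tendsto 0).mono_left (nhdsWithin_le_nhds (s := Set.Ioi 0)))
    (by filter_upwards [self_mem_nhdsWithin] with ε hε using key ε hε)
  simpa using this

theorem mul_integral_deriv_segment {g g' : ℝ → ℝ} (hg : ∀ t, HasDerivAt g (g' t) t)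
    (hg' : Continuous g') (t h : ℝ) :
    h * ∫ s in (0 : ℝ)..1, g' (t + s * h) = g (t + h) - g t := by
  have hd : ∀ s, HasDerivAt (fun s => g (t + s * h)) (h * g' (t + s * h)) s := fun s => by
    have h1 : HasDerivAt (fun s => t + s * h) h s := by
      simpa using ((hasDerivAt_id s).mul_const h).const_add t
    exact ((hg (t + s * h)).comp s h1).congr_deriv (mul_comm _ _)
  rw [← intervalIntegral.integral_const_mul,
    intervalIntegral.integral_eq_sub_of_hasDerivAt (fun s _ => hd s)
      (Continuous.intervalIntegrable (by fun_prop) _ _)]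
  simp

/-- Green's formula `∫∫ d f ∧ d g = ∮ f dg` in polar coordinates, for `C¹` functions. -/
theorem integral_integral_jacobian_eq {f g fr ft gr gt : ℝ → ℝ → ℝ} {R p q : ℝ} (hR : 0 ≤ R)
    (hfc : Continuous (Function.uncurry f)) (hgc : Continuous (Function.uncurry g))
    (hfrc : Continuous (Function.uncurry fr)) (hftc : Continuous (Function.uncurry ft))
    (hgrc : Continuous (Function.uncurry gr)) (hgtc : Continuous (Function.uncurry gt))
    (hfr : ∀ ρ ∈ Set.Ioo 0 R, ∀ θ, HasDerivAt (fun ρ => f ρ θ) (fr ρ θ) ρ)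
    (hgr : ∀ ρ ∈ Set.Ioo 0 R, ∀ θ, HasDerivAt (fun ρ => g ρ θ) (gr ρ θ) ρ)
    (hft : ∀ ρ θ, HasDerivAt (f ρ) (ft ρ θ) θ) (hgt : ∀ ρ θ, HasDerivAt (g ρ) (gt ρ θ) θ)
    (hfp : ∀ ρ, Function.Periodic (f ρ) (q - p)) (hgrp : ∀ ρ, Function.Periodic (gr ρ) (q - p))
    (hg0 : ∀ θ θ', g 0 θ = g 0 θ') :
    ∫ ρ in 0..R, ∫ θ in p..q, (fr ρ θ * gt ρ θ - ft ρ θ * gr ρ θ) =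
      ∫ θ in p..q, f R θ * gt R θ := by
  set Dg : ℝ → ℝ → ℝ → ℝ := fun h ρ θ => ∫ s in (0 : ℝ)..1, gt ρ (θ + s * h) with hDg
  set Df : ℝ → ℝ → ℝ → ℝ := fun h ρ θ => ∫ s in (0 : ℝ)..1, ft ρ (θ + s * h) with hDf
  have hDgc : Continuous fun z : ℝ × ℝ × ℝ => Dg z.1 z.2.1 z.2.2 :=
    intervalIntegral.continuous_parametric_intervalIntegral_of_continuous'
      (f := fun (z : ℝ × ℝ × ℝ) s => gt z.2.1 (z.2.2 + s * z.1)) (by fun_prop) 0 1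
  have hDfc : Continuous fun z : ℝ × ℝ × ℝ => Df z.1 z.2.1 z.2.2 :=
    intervalIntegral.continuous_parametric_intervalIntegral_of_continuous'
      (f := fun (z : ℝ × ℝ × ℝ) s => ft z.2.1 (z.2.2 + s * z.1)) (by fun_prop) 0 1
  have hDge : ∀ h ρ θ, h * Dg h ρ θ = g ρ (θ + h) - g ρ θ := fun h ρ θ =>
    mul_integral_deriv_segment (hgt ρ) (by fun_prop) θ h
  have hDfe : ∀ h ρ θ, h * Df h ρ θ = f ρ (θ + h) - f ρ θ := fun h ρ θ =>
    mul_integral_deriv_segment (hft ρ) (by fun_prop) θ h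
  set A : ℝ → ℝ := fun h => ∫ ρ in 0..R, ∫ θ in p..q,
    (fr ρ θ * Dg h ρ θ - Df (-h) ρ θ * gr ρ θ) with hA
  set B : ℝ → ℝ := fun h => ∫ θ in p..q, f R θ * Dg h R θ with hB
  have hAc : Continuous A := by
    refine intervalIntegral.continuous_parametric_intervalIntegral_of_continuous' ?_ 0 R
    refine intervalIntegral.continuous_parametric_intervalIntegral_of_continuous'
      (f := fun (z : ℝ × ℝ) θ => fr z.2 θ * Dg z.1 z.2 θ - Df (-z.1) z.2 θ * gr z.2 θ) ?_ p q
    have h1 : Continuous fun z : (ℝ × ℝ) × ℝ => Dg z.1.1 z.1.2 z.2 :=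
      hDgc.comp (g := fun z : ℝ × ℝ × ℝ => Dg z.1 z.2.1 z.2.2)
        (f := fun z : (ℝ × ℝ) × ℝ => (z.1.1, z.1.2, z.2)) (by fun_prop)
    have h2 : Continuous fun z : (ℝ × ℝ) × ℝ => Df (-z.1.1) z.1.2 z.2 :=
      hDfc.comp (g := fun z : ℝ × ℝ × ℝ => Df z.1 z.2.1 z.2.2)
        (f := fun z : (ℝ × ℝ) × ℝ => (-z.1.1, z.1.2, z.2)) (by fun_prop)
    simp only [Function.uncurry_def]
    fun_prop
  have hBc : Continuous B := by
    refine intervalIntegral.continuous_parametric_intervalIntegral_of_continuous'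
      (f := fun h θ => f R θ * Dg h R θ) ?_ p q
    have h1 : Continuous fun z : ℝ × ℝ => Dg z.1 R z.2 :=
      hDgc.comp (g := fun z : ℝ × ℝ × ℝ => Dg z.1 z.2.1 z.2.2)
        (f := fun z : ℝ × ℝ => (z.1, R, z.2)) (by fun_prop)
    simp only [Function.uncurry_def]
    fun_prop
  have hAB : ∀ h, h * A h = h * B h := by
    intro h
    have e1 : h * B h = ∫ θ in p..q, f R θ * (g R (θ + h) - g R θ) := by
      rw [hB, ← intervalIntegral.integral_const_mul]
      congr 1; ext θ; rw [← hDge]; ring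
    have e2 : ∀ θ, f R θ * (g R (θ + h) - g R θ) = ∫ ρ in 0..R,
        (fr ρ θ * (g ρ (θ + h) - g ρ θ) + f ρ θ * (gr ρ (θ + h) - gr ρ θ)) := by
      intro θ
      rw [intervalIntegral.integral_eq_sub_of_hasDerivAt_of_le hR
        (f := fun ρ => f ρ θ * (g ρ (θ + h) - g ρ θ))
        (Continuous.continuousOn (by fun_prop))
        (fun ρ hρ => (hfr ρ hρ θ).mul ((hgr ρ hρ (θ + h)).sub (hgr ρ hρ θ)))
        (Continuous.intervalIntegrable (by fun_prop) _ _)]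
      simp [hg0 (θ + h) θ]
    have e3 : h * B h = ∫ ρ in 0..R, ∫ θ in p..q,
        (fr ρ θ * (g ρ (θ + h) - g ρ θ) + f ρ θ * (gr ρ (θ + h) - gr ρ θ)) := by
      rw [e1]
      simp_rw [e2]
      apply intervalIntegral_intervalIntegral_swap
      refine (ContinuousOn.integrableOn_compact (isCompact_uIcc.prod isCompact_uIcc)
        (Continuous.continuousOn ?_)).mono_set
        (Set.prod_mono Set.uIoc_subset_uIcc Set.uIoc_subset_uIcc)
      simp only [Function.uncurry_def]
      fun_prop
    rw [e3, hA, ← intervalIntegral.integral_const_mul]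
    congr 1; ext ρ
    rw [← intervalIntegral.integral_const_mul]
    have e4 : ∫ θ in p..q, f ρ θ * gr ρ (θ + h) = ∫ θ in p..q, f ρ (θ - h) * gr ρ θ := by
      have s1 := intervalIntegral.integral_comp_add_right (a := p) (b := q)
        (fun θ => f ρ (θ - h) * gr ρ θ) h
      simp only [add_sub_cancel_right] at s1
      have hper : Function.Periodic (fun θ => f ρ (θ - h) * gr ρ θ) (q - p) := fun θ => by
        have := hfp ρ (θ - h)
        simp only [hgrp ρ θ]
        rw [← this]; ring_nf
      have s2 := hper.intervalIntegral_add_eq (p + h) p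
      rw [s1]
      convert s2 using 2 <;> ring
    have c1 : Continuous fun θ => f ρ (θ - h) * gr ρ θ := by fun_prop
    have c2 : Continuous fun θ => f ρ θ * gr ρ θ := by fun_prop
    have c3 : Continuous fun θ => f ρ θ * gr ρ (θ + h) := by fun_prop
    have c4 : Continuous fun θ => fr ρ θ * (g ρ (θ + h) - g ρ θ) := by fun_prop
    have c12 : Continuous fun θ => f ρ (θ - h) * gr ρ θ - f ρ θ * gr ρ θ := c1.sub c2
    have c32 : Continuous fun θ => f ρ θ * gr ρ (θ + h) - f ρ θ * gr ρ θ := c3.sub c2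
    have i (φ : ℝ → ℝ) (hφ : Continuous φ) : IntervalIntegrable φ volume p q :=
      hφ.intervalIntegrable _ _
    have l : ∀ θ, h * (fr ρ θ * Dg h ρ θ - Df (-h) ρ θ * gr ρ θ) =
        fr ρ θ * (g ρ (θ + h) - g ρ θ) + (f ρ (θ - h) * gr ρ θ - f ρ θ * gr ρ θ) := by
      intro θ
      have := hDfe (-h) ρ θ
      rw [← sub_eq_add_neg] at this
      rw [← hDge]
      linear_combination gr ρ θ * this
    simp_rw [l, mul_sub (f ρ _)]
    rw [intervalIntegral.integral_add (i _ c4) (i _ c12),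
      intervalIntegral.integral_add (i _ c4) (i _ c32),
      intervalIntegral.integral_sub (i _ c1) (i _ c2),
      intervalIntegral.integral_sub (i _ c3) (i _ c2), e4]
  have hABe : A = B := by
    refine Continuous.ext_on (dense_compl_singleton 0) hAc hBc fun h hh => ?_
    exact mul_left_cancel₀ hh (hAB h)
  have := congrFun hABe 0
  simpa [hA, hB, hDg, hDf] using this

/-- The point of the plane with polar coordinates `(ρ, θ)`. -/
def polarPoint (ρ θ : ℝ) : E2 := !₂[ρ * Real.cos θ, ρ * Real.sin θ]

theorem continuous_polarPoint : Continuous (Function.uncurry polarPoint) := by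
  unfold polarPoint
  simp only [Function.uncurry_def]
  fun_prop

theorem norm_polarPoint (ρ θ : ℝ) : ‖polarPoint ρ θ‖ = |ρ| := by
  rw [EuclideanSpace.norm_eq, ← Real.sqrt_sq_eq_abs]
  congr 1
  simp only [polarPoint, Fin.sum_univ_two, Real.norm_eq_abs, sq_abs]
  simp
  linear_combination ρ ^ 2 * Real.sin_sq_add_cos_sq θ

theorem dist_polarPoint {ρ : ℝ} (hρ : 0 ≤ ρ) (θ φ : ℝ) :
    dist (polarPoint ρ θ) (polarPoint ρ φ) = 2 * ρ * |Real.sin ((θ - φ) / 2)| := by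
  have h : 2 * ρ * |Real.sin ((θ - φ) / 2)| = √((2 * ρ * Real.sin ((θ - φ) / 2)) ^ 2) := by
    rw [Real.sqrt_sq_eq_abs, abs_mul, abs_of_nonneg (by positivity : 0 ≤ 2 * ρ)]
  rw [EuclideanSpace.dist_eq, h, mul_pow (2 * ρ), Real.sin_sq_eq_half_sub,
    mul_div_cancel₀ _ (two_ne_zero' ℝ), Real.cos_sub]
  congr 1
  simp only [polarPoint, Fin.sum_univ_two, Real.dist_eq, sq_abs]
  simp
  linear_combination ρ ^ 2 * (Real.sin_sq_add_cos_sq θ + Real.sin_sq_add_cos_sq φ)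

theorem lipschitzWith_polarPoint {ρ : ℝ} (hρ : 0 ≤ ρ) :
    LipschitzWith ρ.toNNReal (polarPoint ρ) := by
  refine LipschitzWith.of_dist_le_mul fun θ φ => ?_
  rw [dist_polarPoint hρ, Real.coe_toNNReal _ hρ, Real.dist_eq]
  have := Real.abs_sin_le_abs (x := (θ - φ) / 2)
  rw [abs_div, abs_two] at this
  nlinarith

theorem mul_dist_le_dist_polarPoint {ρ κ : ℝ} (hρ : 0 ≤ ρ) (hκ : 0 < κ) {θ φ : ℝ}
    (h : |θ - φ| ≤ 1 - κ) :
    κ * ρ * |θ - φ| ≤ dist (polarPoint ρ θ) (polarPoint ρ φ) := by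
  rw [dist_polarPoint hρ]
  set t := |θ - φ| / 2 with ht
  have h0 : 0 ≤ t := by positivity
  have hs : κ * t ≤ |Real.sin ((θ - φ) / 2)| := by
    have e : |Real.sin ((θ - φ) / 2)| = |Real.sin t| := by
      have : t = |(θ - φ) / 2| := by rw [abs_div, abs_two]
      rw [this]
      rcases abs_choice ((θ - φ) / 2) with h | h <;> rw [h]
      rw [Real.sin_neg, abs_neg]
    rw [e]
    refine le_trans ?_ (le_abs_self _)
    rcases h0.eq_or_lt with h' | h'
    · simp [← h']
    have h1 := Real.sin_gt_sub_cube h'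
    have h2 : t ≤ (1 - κ) / 2 := by linarith
    have h3 : t ^ 2 / 6 ≤ 1 - κ := by nlinarith
    nlinarith [mul_le_mul_of_nonneg_left h3 h0]
  have : |θ - φ| = 2 * t := by rw [ht]; ring
  rw [this]
  nlinarith [mul_le_mul_of_nonneg_left hs hρ]

theorem injOn_polarPoint {ρ : ℝ} (hρ : 0 < ρ) :
    Set.InjOn (polarPoint ρ) (Set.Ioc (-Real.pi) Real.pi) := by
  intro θ hθ φ hφ h
  have h0 := congrArg (fun z : E2 => z 0) h
  have h1 := congrArg (fun z : E2 => z 1) h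
  simp [polarPoint, hρ.ne'] at h0 h1
  have := congrArg Real.Angle.toReal (Real.Angle.cos_sin_inj h0 h1)
  rwa [Real.Angle.toReal_coe_eq_self_iff.2 hθ, Real.Angle.toReal_coe_eq_self_iff.2 hφ] at this

theorem image_polarPoint {ρ : ℝ} (hρ : 0 ≤ ρ) :
    polarPoint ρ '' Set.Ioc (-Real.pi) Real.pi = sphere (0 : E2) ρ := by
  ext z
  constructor
  · rintro ⟨θ, -, rfl⟩
    rw [mem_sphere_zero_iff_norm, norm_polarPoint, abs_of_nonneg hρ]
  · intro hz
    rw [mem_sphere_zero_iff_norm] at hz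
    set w : ℂ := ⟨z 0, z 1⟩ with hw
    have hn : ‖w‖ = ρ := by
      rw [← hz, EuclideanSpace.norm_eq, Complex.norm_eq_sqrt_sq_add_sq]
      simp [Fin.sum_univ_two, hw]
    refine ⟨w.arg, Complex.arg_mem_Ioc w, ?_⟩
    ext i
    fin_cases i
    · simp [polarPoint, ← hn, Complex.norm_mul_cos_arg, hw]
    · simp [polarPoint, ← hn, Complex.norm_mul_sin_arg, hw]

theorem measurableSet_image_polarPoint {ρ : ℝ} (hρ : 0 < ρ) {A : Set ℝ} (hA : MeasurableSet A)
    (hAs : A ⊆ Set.Ioc (-Real.pi) Real.pi) : MeasurableSet (polarPoint ρ '' A) :=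
  hA.image_of_continuousOn_injOn (lipschitzWith_polarPoint hρ.le).continuous.continuousOn
    ((injOn_polarPoint hρ).mono hAs)

theorem mul_volume_le_hausdorffMeasure_polarPoint_of_short {ρ κ : ℝ} (hρ : 0 < ρ) (hκ : 0 < κ)
    {A : Set ℝ} (hA : ∀ θ ∈ A, ∀ φ ∈ A, |θ - φ| ≤ 1 - κ) :
    ENNReal.ofReal (κ * ρ) * volume A ≤ μH[1] (polarPoint ρ '' A) := by
  have hκρ : 0 < κ * ρ := by positivity
  have hanti : AntilipschitzWith (κ * ρ)⁻¹.toNNReal fun t : A => polarPoint ρ t := by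
    refine AntilipschitzWith.of_le_mul_dist fun θ φ => ?_
    rw [Real.coe_toNNReal _ (by positivity), Subtype.dist_eq, Real.dist_eq, inv_mul_eq_div,
      le_div_iff₀ hκρ, mul_comm]
    exact mul_dist_le_dist_polarPoint hρ.le hκ (hA _ θ.2 _ φ.2)
  have h1 := hanti.le_hausdorffMeasure_image zero_le_one Set.univ
  have h2 := (isometry_subtype_coe (s := A)).hausdorffMeasure_image
    (Or.inl (zero_le_one (α := ℝ))) Set.univ
  rw [Set.image_univ, Subtype.range_coe, hausdorffMeasure_real] at h2
  have h3 : (fun t : A => polarPoint ρ t) '' Set.univ = polarPoint ρ '' A := by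
    rw [Set.image_univ, Set.image_eq_range]
  rw [← h2, h3, ENNReal.rpow_one] at h1
  calc _ ≤ ENNReal.ofReal (κ * ρ) * (ENNReal.ofReal (κ * ρ)⁻¹ * μH[1] (polarPoint ρ '' A)) := by
        gcongr; exact h1
    _ = _ := by
        rw [← mul_assoc, ← ENNReal.ofReal_mul hκρ.le, mul_inv_cancel₀ hκρ.ne', ENNReal.ofReal_one,
          one_mul]

theorem hausdorffMeasure_image_polarPoint {ρ : ℝ} (hρ : 0 < ρ) {A : Set ℝ} (hA : MeasurableSet A)
    (hAs : A ⊆ Set.Ioc (-Real.pi) Real.pi) :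
    μH[1] (polarPoint ρ '' A) = ENNReal.ofReal ρ * volume A := by
  apply le_antisymm
  · have := (lipschitzWith_polarPoint hρ.le).hausdorffMeasure_image_le zero_le_one A
    rwa [hausdorffMeasure_real, ENNReal.rpow_one] at this
  have key : ∀ κ ∈ Set.Ioo (0 : ℝ) 1,
      ENNReal.ofReal (κ * ρ) * volume A ≤ μH[1] (polarPoint ρ '' A) := by
    intro κ ⟨hκ, hκ1⟩
    set I : ℤ → Set ℝ := fun n => Set.Ioc (n • (1 - κ)) ((n + 1) • (1 - κ)) with hI
    have hIm : ∀ n, MeasurableSet (I n) := fun n => measurableSet_Ioc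
    have hId : Pairwise (Function.onFun Disjoint I) := by
      have := Set.pairwise_disjoint_Ioc_add_zsmul (0 : ℝ) (1 - κ)
      simpa [hI] using this
    have hU : A = ⋃ n, A ∩ I n := by
      rw [← Set.inter_iUnion, hI, iUnion_Ioc_zsmul (by linarith), Set.inter_univ]
    have hdj : Pairwise (Function.onFun Disjoint fun n => A ∩ I n) := fun i j hij =>
      (hId hij).mono Set.inter_subset_right Set.inter_subset_right
    have hdj' : Pairwise (Function.onFun Disjoint fun n => polarPoint ρ '' (A ∩ I n)) := by
      intro i j hij
      rw [Function.onFun, Set.disjoint_iff_inter_eq_empty, ← (injOn_polarPoint hρ).image_inter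
        (Set.inter_subset_left.trans hAs) (Set.inter_subset_left.trans hAs),
        Set.disjoint_iff_inter_eq_empty.1 (hdj hij), Set.image_empty]
    calc ENNReal.ofReal (κ * ρ) * volume A
        = ∑' n, ENNReal.ofReal (κ * ρ) * volume (A ∩ I n) := by
          conv_lhs => rw [hU]
          rw [measure_iUnion hdj fun n => hA.inter (hIm n), ENNReal.tsum_mul_left]
      _ ≤ ∑' n, μH[1] (polarPoint ρ '' (A ∩ I n)) := by
          refine ENNReal.tsum_le_tsum fun n => ?_
          refine mul_volume_le_hausdorffMeasure_polarPoint_of_short hρ hκ ?_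
          rintro θ ⟨-, h1, h2⟩ φ ⟨-, h3, h4⟩
          rw [add_smul, one_smul] at h2 h4
          rw [abs_le]; constructor <;> linarith
      _ = μH[1] (polarPoint ρ '' A) := by
          conv_rhs => rw [hU, Set.image_iUnion]
          rw [measure_iUnion hdj' fun n => measurableSet_image_polarPoint hρ (hA.inter (hIm n))
            (Set.inter_subset_left.trans hAs)]
  have hlim : Filter.Tendsto (fun κ : ℝ => ENNReal.ofReal (κ * ρ) * volume A)
      (nhdsWithin 1 (Set.Iio 1)) (nhds (ENNReal.ofReal (1 * ρ) * volume A)) := by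
    refine ENNReal.Tendsto.mul_const ?_ (Or.inl (by simpa using hρ))
    refine (ENNReal.continuous_ofReal.tendsto _).comp ?_
    exact (Continuous.tendsto (by fun_prop) 1).mono_left nhdsWithin_le_nhds
  rw [one_mul] at hlim
  refine le_of_tendsto hlim ?_
  filter_upwards [Ioo_mem_nhdsLT (zero_lt_one (α := ℝ))] with κ hκ using key κ hκ

/-- The length measure on a circle is the image of Lebesgue measure on the angles. -/
theorem hausdorffMeasure_restrict_sphere {ρ : ℝ} (hρ : 0 < ρ) :
    (μH[1] : Measure E2).restrict (sphere 0 ρ) = ENNReal.ofReal ρ •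
      (volume.restrict (Set.Ioc (-Real.pi) Real.pi)).map (polarPoint ρ) := by
  have hm : Measurable (polarPoint ρ) := (lipschitzWith_polarPoint hρ.le).continuous.measurable
  ext B hB
  rw [Measure.restrict_apply hB, Measure.smul_apply, Measure.map_apply hm hB,
    Measure.restrict_apply (hm hB), smul_eq_mul, ← hausdorffMeasure_image_polarPoint hρ
    ((hm hB).inter measurableSet_Ioc) Set.inter_subset_right, Set.image_preimage_inter,
    image_polarPoint hρ.le]

theorem setIntegral_sphere_hausdorffMeasure {ρ : ℝ} (hρ : 0 < ρ) {f : E2 → ℝ}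
    (hf : ContinuousOn f (sphere 0 ρ)) :
    ∫ x in sphere (0 : E2) ρ, f x ∂μH[1] =
      ∫ θ in (-Real.pi)..Real.pi, ρ * f (polarPoint ρ θ) := by
  have hm : Measurable (polarPoint ρ) := (lipschitzWith_polarPoint hρ.le).continuous.measurable
  have hae : AEStronglyMeasurable f ((μH[1] : Measure E2).restrict (sphere 0 ρ)) :=
    hf.aestronglyMeasurable isClosed_sphere.measurableSet
  rw [hausdorffMeasure_restrict_sphere hρ] at hae ⊢
  have hae' := hae.mono_ac (Measure.absolutelyContinuous_smul (c := ENNReal.ofReal ρ) (by simpa using hρ))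
  rw [integral_smul_measure, integral_map hm.aemeasurable hae',
    ENNReal.toReal_ofReal hρ.le, intervalIntegral.integral_of_le (by linarith [Real.pi_pos]),
    integral_const_mul, smul_eq_mul]

theorem polarPoint_eq (ρ θ : ℝ) :
    polarPoint ρ θ = (ρ * Real.cos θ) • e2 0 + (ρ * Real.sin θ) • e2 1 := by
  ext i
  fin_cases i <;> simp [polarPoint, e2]

theorem hasDerivAt_polarPoint_angle (ρ θ : ℝ) : HasDerivAt (polarPoint ρ)
    ((-(ρ * Real.sin θ)) • e2 0 + (ρ * Real.cos θ) • e2 1) θ := by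
  have : polarPoint ρ = fun θ => (ρ * Real.cos θ) • e2 0 + (ρ * Real.sin θ) • e2 1 :=
    funext (polarPoint_eq ρ)
  rw [this]
  refine ((((Real.hasDerivAt_cos θ).const_mul ρ).smul_const (e2 0)).add
    (((Real.hasDerivAt_sin θ).const_mul ρ).smul_const (e2 1))).congr_deriv ?_
  rw [mul_neg]

theorem hasDerivAt_polarPoint_radius (ρ θ : ℝ) : HasDerivAt (fun ρ => polarPoint ρ θ)
    (Real.cos θ • e2 0 + Real.sin θ • e2 1) ρ := by
  simp only [polarPoint_eq]
  exact ((hasDerivAt_mul_const _).smul_const (e2 0)).add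
    ((hasDerivAt_mul_const _).smul_const (e2 1))

theorem setIntegral_ball_eq_polar {R : ℝ} (hR : 0 ≤ R) {F : E2 → ℝ}
    (hF : ContinuousOn F (closedBall 0 R)) :
    ∫ x in ball (0 : E2) R, F x =
      ∫ ρ in 0..R, ∫ θ in (-Real.pi)..Real.pi, ρ * F (polarPoint ρ θ) := by
  set e : ℝ × ℝ ≃ᵐ E2 := MeasurableEquiv.finTwoArrow.symm.trans (MeasurableEquiv.toLp 2 _)
  have he : MeasurePreserving e :=
    ((volume_preserving_finTwoArrow ℝ).symm).trans
      (EuclideanSpace.volume_preserving_symm_measurableEquiv_toLp (Fin 2)).symm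
  have hep : ∀ ρ θ, e (polarCoord.symm (ρ, θ)) = polarPoint ρ θ := fun ρ θ => rfl
  have hint : IntegrableOn (fun p : ℝ × ℝ => p.1 * F (polarPoint p.1 p.2))
      (Set.Ioo 0 R ×ˢ Set.Ioo (-Real.pi) Real.pi) (volume.prod volume) := by
    refine (ContinuousOn.integrableOn_compact (K := Set.Icc 0 R ×ˢ Set.Icc (-Real.pi) Real.pi)
      (isCompact_Icc.prod isCompact_Icc) ?_).mono_set
      (Set.prod_mono Set.Ioo_subset_Icc_self Set.Ioo_subset_Icc_self)
    refine continuousOn_fst.mul (hF.comp continuous_polarPoint.continuousOn ?_)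
    rintro ⟨ρ, θ⟩ ⟨⟨h0, h1⟩, -⟩
    rw [mem_closedBall_zero_iff]
    simpa [Function.uncurry, norm_polarPoint, abs_of_nonneg h0] using h1
  rw [← integral_indicator measurableSet_ball, ← he.integral_comp', ← integral_comp_polarCoord_symm]
  have hset : Set.Ioo 0 R ×ˢ Set.Ioo (-Real.pi) Real.pi ⊆ polarCoord.target :=
    Set.prod_mono Set.Ioo_subset_Ioi_self subset_rfl
  have hind : ∀ p ∈ polarCoord.target,
      p.1 • (ball (0 : E2) R).indicator F (e (polarCoord.symm p)) =
      (Set.Ioo 0 R ×ˢ Set.Ioo (-Real.pi) Real.pi).indicator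
        (fun p : ℝ × ℝ => p.1 * F (polarPoint p.1 p.2)) p := by
    rintro ⟨ρ, θ⟩ ⟨hρ, hθ⟩
    rw [hep]
    simp only [Set.mem_Ioi] at hρ
    by_cases h : ρ < R
    · rw [Set.indicator_of_mem (by simpa [norm_polarPoint, abs_of_pos hρ] using h),
        Set.indicator_of_mem (Set.mk_mem_prod (Set.mem_Ioo.2 ⟨hρ, h⟩) hθ), smul_eq_mul]
    · rw [Set.indicator_of_notMem (by simpa [norm_polarPoint, abs_of_pos hρ] using h),
        Set.indicator_of_notMem (fun h' => h h'.1.2), smul_zero]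
  rw [setIntegral_congr_fun polarCoord.open_target.measurableSet hind,
    setIntegral_indicator (measurableSet_Ioo.prod measurableSet_Ioo),
    Set.inter_eq_right.2 hset, Measure.volume_eq_prod, setIntegral_prod _ hint,
    intervalIntegral.integral_of_le hR, integral_Ioc_eq_integral_Ioo]
  congr 1
  ext ρ
  rw [intervalIntegral.integral_of_le (by linarith [Real.pi_pos]), integral_Ioc_eq_integral_Ioo]

theorem uniqueDiffOn_D : UniqueDiffOn ℝ D := by
  refine uniqueDiffOn_convex (convex_closedBall _ _) ?_
  rw [D, interior_closedBall _ one_ne_zero]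
  exact nonempty_ball.2 one_pos

theorem contDiffOn_fderivWithin_e2 {v : E2 → ℝ} (hv : ContDiffOn ℝ 2 v D) (i : Fin 2) :
    ContDiffOn ℝ 1 (fun z => fderivWithin ℝ v D z (e2 i)) D :=
  (hv.fderivWithin uniqueDiffOn_D (m := 1) (by norm_num)).clm_apply contDiffOn_const

theorem continuousOn_hessD {v : E2 → ℝ} (hv : ContDiffOn ℝ 2 v D) (i j : Fin 2) :
    ContinuousOn (fun x => hessD v x i j) D :=
  ((contDiffOn_fderivWithin_e2 hv i).continuousOn_fderivWithin uniqueDiffOn_D le_rfl).clm_apply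
    continuousOn_const

theorem continuousOn_hessFrobD {v : E2 → ℝ} (hv : ContDiffOn ℝ 2 v D) :
    ContinuousOn (hessFrobD v) D := by
  have := continuousOn_hessD hv
  unfold hessFrobD
  fun_prop

theorem continuousOn_hessDetD {v : E2 → ℝ} (hv : ContDiffOn ℝ 2 v D) :
    ContinuousOn (hessDetD v) D := by
  have := continuousOn_hessD hv
  unfold hessDetD
  fun_prop

theorem hasDerivAt_fderivWithin_comp {v : E2 → ℝ} (hv : ContDiffOn ℝ 2 v D) (i : Fin 2)
    {γ : ℝ → E2} {t a b : ℝ} (hγ : HasDerivAt γ (a • e2 0 + b • e2 1) t)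
    (hD : ∀ᶠ s in nhds t, γ s ∈ D) :
    HasDerivAt (fun s => fderivWithin ℝ v D (γ s) (e2 i))
      (a * hessD v (γ t) i 0 + b * hessD v (γ t) i 1) t := by
  have h := (((contDiffOn_fderivWithin_e2 hv i).differentiableOn one_ne_zero) _
    hD.self_of_nhds).hasFDerivWithinAt.comp_hasDerivAt t hγ hD
  refine h.congr_deriv ?_
  simp [hessD]

theorem sq_mul_add_mul_le {a b p q : ℝ} :
    (a * p + b * q) ^ 2 ≤ (a ^ 2 + b ^ 2) * (p ^ 2 + q ^ 2) := by
  nlinarith [sq_nonneg (a * q - b * p)]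

/-- For a `C²` function `v` on the closed unit disc and `0 ≤ r ≤ 1`, the
integral of `|D²v|` over the circle `∂B_r` (w.r.t. 1-dimensional Hausdorff
measure) is at least `√(4π |∫_{B_r} det D²v|)`. -/
theorem stmt0 (v : E2 → ℝ) (hv : ContDiffOn ℝ 2 v D)
    (r : ℝ) (hr0 : 0 ≤ r) (hr1 : r ≤ 1) :
    Real.sqrt (4 * Real.pi * |∫ x in ball (0 : E2) r, hessDetD v x|)
      ≤ ∫ x in sphere (0 : E2) r, hessFrobD v x ∂(μH[1]) := by
  rcases hr0.eq_or_lt with rfl | hr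
  · rw [ball_zero, setIntegral_empty, abs_zero, mul_zero, Real.sqrt_zero]
    exact integral_nonneg (f := hessFrobD v) fun x => Real.sqrt_nonneg _
  have hrD : closedBall (0 : E2) r ⊆ D := closedBall_subset_closedBall hr1
  rw [setIntegral_sphere_hausdorffMeasure hr
    ((continuousOn_hessFrobD hv).mono (sphere_subset_closedBall.trans hrD)),
    setIntegral_ball_eq_polar hr0 ((continuousOn_hessDetD hv).mono hrD)]
  set κ : ℝ → ℝ := fun ρ => max 0 (min ρ 1) with hκ
  have hκc : Continuous κ := by fun_prop
  have hκid : ∀ ρ, 0 ≤ ρ → ρ ≤ 1 → κ ρ = ρ := fun ρ h0 h1 => by simp [hκ, h0, h1]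
  have hPD : ∀ ρ θ, polarPoint (κ ρ) θ ∈ D := fun ρ θ => by
    rw [D, mem_closedBall_zero_iff, norm_polarPoint, abs_of_nonneg (le_max_left _ _)]
    exact max_le zero_le_one (min_le_right _ _)
  have hPc : Continuous fun z : ℝ × ℝ => polarPoint (κ z.1) z.2 :=
    continuous_polarPoint.comp (f := fun z : ℝ × ℝ => (κ z.1, z.2)) (by fun_prop)
  have hHc : ∀ i j, Continuous fun z : ℝ × ℝ => hessD v (polarPoint (κ z.1) z.2) i j :=
    fun i j => (continuousOn_hessD hv i j).comp_continuous hPc fun z => hPD _ _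
  have hPper : ∀ ρ θ, polarPoint ρ (θ + (Real.pi - -Real.pi)) = polarPoint ρ θ := fun ρ θ => by
    rw [show θ + (Real.pi - -Real.pi) = θ + 2 * Real.pi by ring]
    simp [polarPoint]
  set u : Fin 2 → ℝ → ℝ → ℝ := fun i ρ θ =>
    fderivWithin ℝ v D (polarPoint (κ ρ) θ) (e2 i) with hu
  set ur : Fin 2 → ℝ → ℝ → ℝ := fun i ρ θ =>
    Real.cos θ * hessD v (polarPoint (κ ρ) θ) i 0 +
      Real.sin θ * hessD v (polarPoint (κ ρ) θ) i 1 with hur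
  set ut : Fin 2 → ℝ → ℝ → ℝ := fun i ρ θ =>
    -(κ ρ * Real.sin θ) * hessD v (polarPoint (κ ρ) θ) i 0 +
      (κ ρ * Real.cos θ) * hessD v (polarPoint (κ ρ) θ) i 1 with hut
  have huc : ∀ i, Continuous (Function.uncurry (u i)) := fun i =>
    (contDiffOn_fderivWithin_e2 hv i).continuousOn.comp_continuous hPc fun z => hPD _ _
  have hurc : ∀ i, Continuous (Function.uncurry (ur i)) := fun i => by
    simp only [hur, Function.uncurry_def]
    have := hHc i
    fun_prop
  have hutc : ∀ i, Continuous (Function.uncurry (ut i)) := fun i => by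
    simp only [hut, Function.uncurry_def]
    have := hHc i
    fun_prop
  have hud : ∀ i ρ θ, HasDerivAt (u i ρ) (ut i ρ θ) θ := fun i ρ θ =>
    hasDerivAt_fderivWithin_comp hv i (hasDerivAt_polarPoint_angle (κ ρ) θ)
      (Filter.Eventually.of_forall fun s => hPD ρ s)
  have hurd : ∀ i, ∀ ρ ∈ Set.Ioo 0 r, ∀ θ,
      HasDerivAt (fun ρ => u i ρ θ) (ur i ρ θ) ρ := fun i ρ hρ θ => by
    have hκ1 : κ =ᶠ[nhds ρ] id := by
      filter_upwards [isOpen_Ioo.mem_nhds hρ] with s hs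
      exact hκid s hs.1.le (hs.2.le.trans hr1)
    have hγ : HasDerivAt (fun ρ => polarPoint (κ ρ) θ)
        (Real.cos θ • e2 0 + Real.sin θ • e2 1) ρ :=
      (hasDerivAt_polarPoint_radius ρ θ).congr_of_eventuallyEq
        (hκ1.mono fun s hs => by simp only [hs, id])
    exact hasDerivAt_fderivWithin_comp hv i hγ (Filter.Eventually.of_forall fun s => hPD s θ)
  have hgreen := integral_integral_jacobian_eq (p := -Real.pi) (q := Real.pi) hr0 (huc 0) (huc 1)
    (hurc 0) (hutc 0) (hurc 1) (hutc 1) (hurd 0) (hurd 1) (hud 0) (hud 1)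
    (fun ρ θ => by simp only [hu, hPper])
    (fun ρ θ => by
      have hc := Real.cos_periodic θ
      have hs := Real.sin_periodic θ
      rw [show 2 * Real.pi = Real.pi - -Real.pi by ring] at hc hs
      simp only [hur, hPper, hc, hs])
    (fun θ θ' => by simp [hu, hκ, polarPoint])
  have hjac : ∫ ρ in 0..r, ∫ θ in (-Real.pi)..Real.pi, ρ * hessDetD v (polarPoint ρ θ) =
      ∫ ρ in 0..r, ∫ θ in (-Real.pi)..Real.pi,
        (ur 0 ρ θ * ut 1 ρ θ - ut 0 ρ θ * ur 1 ρ θ) := by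
    refine intervalIntegral.integral_congr fun ρ hρ => ?_
    rw [Set.uIcc_of_le hr0] at hρ
    refine intervalIntegral.integral_congr fun θ _ => ?_
    simp only [hur, hut, hκid ρ hρ.1 (hρ.2.trans hr1), hessDetD]
    linear_combination (-ρ * (hessD v (polarPoint ρ θ) 0 0 * hessD v (polarPoint ρ θ) 1 1 -
      hessD v (polarPoint ρ θ) 0 1 * hessD v (polarPoint ρ θ) 1 0)) * Real.sin_sq_add_cos_sq θ
  rw [hjac, hgreen]
  have hκr : κ r = r := hκid r hr0 hr1
  have hfrob0 : ∀ θ, 0 ≤ r * hessFrobD v (polarPoint r θ) := fun θ =>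
    mul_nonneg hr0 (Real.sqrt_nonneg _)
  have hfrobc : Continuous fun θ => r * hessFrobD v (polarPoint r θ) := by
    refine continuous_const.mul ((continuousOn_hessFrobD hv).comp_continuous
      (lipschitzWith_polarPoint hr0).continuous fun θ => ?_)
    rw [← hκr]; exact hPD r θ
  have hper : ∀ i, u i r (-Real.pi) = u i r Real.pi := fun i => by
    have := hPper (κ r) (-Real.pi)
    rw [show -Real.pi + (Real.pi - -Real.pi) = Real.pi by ring] at this
    simp only [hu, this]
  have hiso := abs_integral_mul_deriv_le_of_closed (a := -Real.pi) (b := Real.pi)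
    (by linarith [Real.pi_pos]) (hud 1 r) (hud 0 r) (by have := hutc 1; fun_prop)
    (by have := hutc 0; fun_prop) hfrobc hfrob0
    (fun θ => by
      have hb : ∀ i, ut i r θ ^ 2 ≤ r ^ 2 *
          (hessD v (polarPoint r θ) i 0 ^ 2 + hessD v (polarPoint r θ) i 1 ^ 2) := fun i => by
        have h := sq_mul_add_mul_le (a := -(r * Real.sin θ)) (b := r * Real.cos θ)
          (p := hessD v (polarPoint r θ) i 0) (q := hessD v (polarPoint r θ) i 1)
        have e : (-(r * Real.sin θ)) ^ 2 + (r * Real.cos θ) ^ 2 = r ^ 2 := by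
          linear_combination r ^ 2 * Real.sin_sq_add_cos_sq θ
        rw [e] at h
        simpa only [hut, hκr] using h
      have hF : hessFrobD v (polarPoint r θ) ^ 2 =
          hessD v (polarPoint r θ) 0 0 ^ 2 + hessD v (polarPoint r θ) 0 1 ^ 2 +
          (hessD v (polarPoint r θ) 1 0 ^ 2 + hessD v (polarPoint r θ) 1 1 ^ 2) := by
        rw [hessFrobD, Real.sq_sqrt (by positivity)]
        simp only [Fin.sum_univ_two]
      rw [mul_pow, hF]
      linarith [hb 0, hb 1]) (hper 1) (hper 0)
  exact (Real.sqrt_le_sqrt hiso).trans_eq (Real.sqrt_sq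
    (intervalIntegral.integral_nonneg (by linarith [Real.pi_pos]) fun θ _ => hfrob0 θ))
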